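/- arXiv:1903.03585 — 6 statements merged into one kernel-verified Lean document; each statement's English description precedes it below -/
import Mathlib

section
/- For every k ≥ 3 and n = 2k+1, there exists an intersecting family 𝓕 ⊆ 2^[n] with div(𝓕) > ∑_{i=k+1}^{2k} C(2k,i). (This disproves Huang's conjecture that every intersecting family 𝓕 ⊆ 2^[2k+1] satisfies div(𝓕) ≤ ∑_{i=k+1}^{2k} C(2k,i).) -/
/-- The diversity `div(𝓕) = |𝓕| - max_{x ∈ [n]} |𝓕(x)|` of a family `𝓕 ⊆ 2^[n]`. -/
def diversity {n : ℕ} (𝓕 : Finset (Finset (Fin n))) : ℕ :=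
  𝓕.card - Finset.univ.sup (fun x : Fin n => (𝓕.filter (fun A => x ∈ A)).card)

open Finset in
theorem card_filter_notMem_of_lt_card {V : Type*} [Fintype V] [DecidableEq V] {k : ℕ}
    (hV : Fintype.card V = 2 * k + 1) (x : V) :
    #{A : Finset V | k + 1 ≤ #A ∧ x ∉ A} = ∑ i ∈ Icc (k + 1) (2 * k), (2 * k).choose i := by
  have hx : #(univ.erase x) = 2 * k := by
    rw [card_erase_of_mem (mem_univ x), card_univ, hV, Nat.add_sub_cancel]
  have h : ({A : Finset V | k + 1 ≤ #A ∧ x ∉ A} : Finset (Finset V)) =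
      (Icc (k + 1) (2 * k)).biUnion fun i => powersetCard i (univ.erase x) := by
    ext A
    simp only [mem_filter, mem_univ, true_and, mem_biUnion, mem_Icc, mem_powersetCard]
    constructor
    · rintro ⟨hA, hxA⟩
      have hs : A ⊆ univ.erase x := fun y hy =>
        mem_erase.2 ⟨fun hyx => hxA (hyx ▸ hy), mem_univ y⟩
      exact ⟨#A, ⟨hA, hx ▸ card_le_card hs⟩, hs, rfl⟩
    · rintro ⟨i, ⟨hi, -⟩, hs, rfl⟩
      exact ⟨hi, fun hxA => notMem_erase x univ (hs hxA)⟩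
  rw [h, card_biUnion fun i _ j _ hij => pairwise_disjoint_powersetCard _ hij]
  simp [card_powersetCard, hx]

open Finset in
theorem lt_diversity_iff {n N : ℕ} [NeZero n] (𝓕 : Finset (Finset (Fin n))) :
    N < diversity 𝓕 ↔ ∀ x, N < #{A ∈ 𝓕 | x ∉ A} := by
  have key : ∀ x, #{A ∈ 𝓕 | x ∈ A} + #{A ∈ 𝓕 | x ∉ A} = #𝓕 := fun x =>
    card_filter_add_card_filter_not _
  unfold diversity
  constructor
  · intro h x
    have h₁ := key x
    have h₂ := le_sup (f := fun x : Fin n => #{A ∈ 𝓕 | x ∈ A}) (mem_univ x)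
    omega
  · intro h
    obtain ⟨x, -, hx⟩ := exists_mem_eq_sup univ ⟨0, mem_univ _⟩
      (fun x : Fin n => #{A ∈ 𝓕 | x ∈ A})
    rw [hx]
    have h₁ := key x
    have h₂ := h x
    omega

/-- A `k`-uniform intersecting family in which every point lies in fewer than half of the sets. -/
structure IsSparseIntersecting {V : Type*} [DecidableEq V] (k : ℕ)
    (𝓖 : Finset (Finset V)) : Prop where
  card_eq : ∀ A ∈ 𝓖, A.card = k
  inter_nonempty : ∀ A ∈ 𝓖, ∀ B ∈ 𝓖, (A ∩ B).Nonempty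
  card_lt : ∀ x, 𝓖.card < 2 * (𝓖.filter (fun A => x ∉ A)).card

open Finset in
theorem IsSparseIntersecting.map {V W : Type*} [DecidableEq V] [DecidableEq W] {k : ℕ}
    {𝓖 : Finset (Finset V)} (h : IsSparseIntersecting k 𝓖) (e : V ≃ W) :
    IsSparseIntersecting k (𝓖.map (mapEmbedding e.toEmbedding).toEmbedding) where
  card_eq := by
    simp only [mem_map]
    rintro _ ⟨A, hA, rfl⟩
    simpa using h.card_eq A hA
  inter_nonempty := by
    simp only [mem_map]
    rintro _ ⟨A, hA, rfl⟩ _ ⟨B, hB, rfl⟩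
    obtain ⟨x, hx⟩ := h.inter_nonempty A hA B hB
    rw [mem_inter] at hx
    exact ⟨e x, by simpa using hx⟩
  card_lt x := by
    have := h.card_lt (e.symm x)
    rw [filter_map, card_map, card_map]
    convert this using 5 with A
    simp [Finset.mem_map_equiv]

open Finset in
/-- Replace, in the family of all sets of size at least `k + 1`, the complements of the members
of `𝓖` by the members of `𝓖`. -/
def majoritySwap {V : Type*} [Fintype V] [DecidableEq V] (k : ℕ)
    (𝓖 : Finset (Finset V)) : Finset (Finset V) :=
  {A | (k + 1 ≤ #A ∧ Aᶜ ∉ 𝓖) ∨ A ∈ 𝓖}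

open Finset in
theorem IsSparseIntersecting.majoritySwap_inter_nonempty {V : Type*} [Fintype V] [DecidableEq V]
    {k : ℕ} (hV : Fintype.card V = 2 * k + 1) {𝓖 : Finset (Finset V)}
    (h : IsSparseIntersecting k 𝓖) :
    ∀ A ∈ majoritySwap k 𝓖, ∀ B ∈ majoritySwap k 𝓖, (A ∩ B).Nonempty := by
  have swap : ∀ A B : Finset V, k + 1 ≤ #A → Aᶜ ∉ 𝓖 → B ∈ 𝓖 → (A ∩ B).Nonempty := by
    intro A B hA hA' hB
    rw [← not_disjoint_iff_nonempty_inter]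
    intro hd
    have hsub : B ⊆ Aᶜ := subset_compl_iff_disjoint_left.2 hd
    have hc := card_compl A
    have hBA : B = Aᶜ := eq_of_subset_of_card_le hsub (by rw [h.card_eq B hB]; omega)
    exact hA' (hBA ▸ hB)
  intro A hA B hB
  simp only [majoritySwap, mem_filter, mem_univ, true_and] at hA hB
  rcases hA with ⟨hA, hA'⟩ | hA <;> rcases hB with ⟨hB, hB'⟩ | hB
  · rw [← not_disjoint_iff_nonempty_inter]
    intro hd
    have := card_le_univ (A ∪ B)
    rw [card_union_of_disjoint hd] at this
    omega
  · exact swap A B hA hA' hB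
  · rw [inter_comm]
    exact swap B A hB hB' hA
  · exact h.inter_nonempty A hA B hB

open Finset in
theorem IsSparseIntersecting.lt_card_majoritySwap {V : Type*} [Fintype V] [DecidableEq V] {k : ℕ}
    (hV : Fintype.card V = 2 * k + 1) {𝓖 : Finset (Finset V)}
    (h : IsSparseIntersecting k 𝓖) (x : V) :
    ∑ i ∈ Icc (k + 1) (2 * k), (2 * k).choose i < #{A ∈ majoritySwap k 𝓖 | x ∉ A} := by
  rw [← card_filter_notMem_of_lt_card hV x]
  have hsplit : {A ∈ majoritySwap k 𝓖 | x ∉ A} =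
      {A ∈ ({A : Finset V | k + 1 ≤ #A ∧ x ∉ A} : Finset (Finset V)) | Aᶜ ∉ 𝓖} ∪
        {A ∈ 𝓖 | x ∉ A} := by
    ext A
    simp only [majoritySwap, mem_filter, mem_univ, true_and, mem_union]
    tauto
  have hdisj : Disjoint
      {A ∈ ({A : Finset V | k + 1 ≤ #A ∧ x ∉ A} : Finset (Finset V)) | Aᶜ ∉ 𝓖}
      {A ∈ 𝓖 | x ∉ A} := by
    rw [disjoint_left]
    intro A hA hA'
    simp only [mem_filter, mem_univ, true_and] at hA hA'
    have := h.card_eq A hA'.1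
    omega
  have hcompl : #{A ∈ ({A : Finset V | k + 1 ≤ #A ∧ x ∉ A} : Finset (Finset V)) | Aᶜ ∈ 𝓖} ≤
      #{A ∈ 𝓖 | x ∈ A} := by
    refine card_le_card_of_injOn compl ?_ compl_injective.injOn
    intro A hA
    simp only [coe_filter, mem_filter, mem_univ, true_and, Set.mem_ofPred_eq, mem_compl] at hA ⊢
    exact ⟨hA.2, hA.1.2⟩
  have h₁ := card_filter_add_card_filter_not
    (s := ({A : Finset V | k + 1 ≤ #A ∧ x ∉ A} : Finset (Finset V))) (fun A => Aᶜ ∈ 𝓖)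
  have h₂ := card_filter_add_card_filter_not (s := 𝓖) (fun A => x ∈ A)
  have h₃ := h.card_lt x
  rw [hsplit, card_union_of_disjoint hdisj]
  omega

/-- The seven lines of the Fano plane. -/
def fanoLines : Finset (Finset (Fin 7)) :=
  {{0, 1, 2}, {0, 3, 4}, {0, 5, 6}, {1, 3, 5}, {1, 4, 6}, {2, 3, 6}, {2, 4, 5}}

open Finset in
theorem card_filter_fanoLines_notMem : ∀ x, #{L ∈ fanoLines | x ∉ L} = 4 := by decide

open Finset in
theorem card_of_mem_fanoLines : ∀ L ∈ fanoLines, #L = 3 := by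
  simp [fanoLines]

open Finset in
set_option maxRecDepth 8000 in
theorem inter_nonempty_of_mem_insert_fanoLines :
    ∀ K ∈ insert {0, 1, 2, 3} fanoLines, ∀ L ∈ insert {0, 1, 2, 3} fanoLines,
      (K ∩ L).Nonempty := by
  decide

open Finset in
/-- The embedding of pairs of sets into sets of a disjoint sum. -/
def disjSumEmbedding (α β : Type*) : Finset α × Finset β ↪ Finset (α ⊕ β) where
  toFun p := p.1.disjSum p.2
  inj' := by
    rintro ⟨a, b⟩ ⟨c, d⟩ h
    simp only [Finset.ext_iff, Sum.forall, inl_mem_disjSum, inr_mem_disjSum] at h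
    exact Prod.ext (Finset.ext h.1) (Finset.ext h.2)

theorem disjSumEmbedding_apply {α β : Type*} (p : Finset α × Finset β) :
    disjSumEmbedding α β p = p.1.disjSum p.2 :=
  rfl

open Finset in
/-- Extensions of Fano lines by `j`-sets, and of one fixed 4-set containing a line by
`(j - 1)`-sets, as pairs. -/
def fanoPairs (j : ℕ) : Finset (Finset (Fin 7) × Finset (Fin (2 * j))) :=
  fanoLines ×ˢ ({T | #T = j} : Finset (Finset (Fin (2 * j)))) ∪
    {{0, 1, 2, 3}} ×ˢ ({T | #T + 1 = j} : Finset (Finset (Fin (2 * j))))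

open Finset in
theorem card_filter_fanoPairs (j : ℕ) (p : Finset (Fin 7) → Prop) [DecidablePred p]
    (q : Finset (Fin (2 * j)) → Prop) [DecidablePred q] :
    #{P ∈ fanoPairs j | p P.1 ∧ q P.2} =
      #{L ∈ fanoLines | p L} * #{T : Finset (Fin (2 * j)) | #T = j ∧ q T} +
      #{L ∈ ({{0, 1, 2, 3}} : Finset (Finset (Fin 7))) | p L} *
        #{T : Finset (Fin (2 * j)) | #T + 1 = j ∧ q T} := by
  have hdisj : Disjoint fanoLines {{0, 1, 2, 3}} := by decide
  rw [fanoPairs, filter_union, filter_product, filter_product, card_union_of_disjoint,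
    card_product, card_product, filter_filter, filter_filter]
  exact disjoint_product.2 (Or.inl (disjoint_filter_filter hdisj))

open Finset in
theorem card_filter_card_eq (m r : ℕ) : #{T : Finset (Fin m) | #T = r} = m.choose r := by
  rw [← Fintype.card_subtype, Fintype.card_finset_len, Fintype.card_fin]

open Finset in
theorem card_filter_card_eq_and_notMem {m : ℕ} (r : ℕ) (y : Fin (m + 1)) :
    #{T : Finset (Fin (m + 1)) | #T = r ∧ y ∉ T} = m.choose r := by
  have : ({T : Finset (Fin (m + 1)) | #T = r ∧ y ∉ T} : Finset (Finset (Fin (m + 1)))) =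
      powersetCard r (univ.erase y) := by
    ext T
    simp only [mem_filter, mem_univ, true_and, mem_powersetCard, subset_erase, subset_univ]
    tauto
  rw [this, card_powersetCard, card_erase_of_mem (mem_univ y), card_univ, Fintype.card_fin,
    Nat.add_sub_cancel]

open Finset in
theorem card_filter_card_succ_lt (j : ℕ) :
    #{T : Finset (Fin (2 * j)) | #T + 1 = j} < #{T : Finset (Fin (2 * j)) | #T = j} := by
  cases j with
  | zero => decide
  | succ i =>
    simp only [Nat.add_right_cancel_iff, card_filter_card_eq]
    have h := Nat.choose_succ_right_eq (2 * (i + 1)) i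
    rw [show 2 * (i + 1) - i = i + 2 by omega] at h
    have hpos : 0 < (2 * (i + 1)).choose i := Nat.choose_pos (by omega)
    nlinarith

open Finset in
theorem card_fanoPairs (j : ℕ) :
    #(fanoPairs j) = 7 * #{T : Finset (Fin (2 * j)) | #T = j} +
      #{T : Finset (Fin (2 * j)) | #T + 1 = j} := by
  have h := card_filter_fanoPairs j (fun _ => True) (fun _ => True)
  simpa [show #fanoLines = 7 by decide] using h

open Finset in
theorem card_fanoPairs_lt_fst (j : ℕ) (x : Fin 7) :
    #(fanoPairs j) < 2 * #{P ∈ fanoPairs j | x ∉ P.1} := by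
  have h := card_filter_fanoPairs j (fun L => x ∉ L) (fun _ => True)
  have hx : #{L ∈ fanoLines | x ∉ L} = 4 := card_filter_fanoLines_notMem x
  simp only [and_true, hx] at h
  have := card_filter_card_succ_lt j
  rw [h, card_fanoPairs]
  omega

open Finset in
theorem card_fanoPairs_lt_snd (j : ℕ) (y : Fin (2 * j)) :
    #(fanoPairs j) < 2 * #{P ∈ fanoPairs j | y ∉ P.2} := by
  have h := card_filter_fanoPairs j (fun _ => True) (fun T => y ∉ T)
  simp only [true_and, filter_true, show #fanoLines = 7 by decide, card_singleton, one_mul] at h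
  rw [h, card_fanoPairs]
  cases j with
  | zero => exact y.elim0
  | succ i =>
    simp only [Nat.add_right_cancel_iff, card_filter_card_eq]
    have h₁ := card_filter_card_eq_and_notMem (m := 2 * i + 1) (i + 1) y
    have h₂ := card_filter_card_eq_and_notMem (m := 2 * i + 1) i y
    have e₁ := Nat.choose_mul_succ_eq (2 * i + 1) (i + 1)
    have e₂ := Nat.choose_mul_succ_eq (2 * i + 1) i
    rw [show 2 * i + 1 + 1 - (i + 1) = i + 1 by omega] at e₁
    rw [show 2 * i + 1 + 1 - i = i + 2 by omega] at e₂
    have hpos : 0 < (2 * i + 1 + 1).choose i := Nat.choose_pos (by omega)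
    change 7 * (2 * i + 1 + 1).choose (i + 1) + (2 * i + 1 + 1).choose i <
      2 * (7 * #{T : Finset (Fin (2 * i + 1 + 1)) | #T = i + 1 ∧ y ∉ T} +
        #{T : Finset (Fin (2 * i + 1 + 1)) | #T = i ∧ y ∉ T})
    rw [h₁, h₂]
    have e₃ : 2 * (2 * i + 1).choose (i + 1) = (2 * i + 1 + 1).choose (i + 1) :=
      Nat.eq_of_mul_eq_mul_right (Nat.succ_pos i) (by linarith)
    have e₄ : (2 * i + 1 + 1).choose i < 2 * (2 * i + 1).choose i := by nlinarith
    omega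

open Finset in
theorem isSparseIntersecting_fanoPairs (j : ℕ) :
    IsSparseIntersecting (j + 3) ((fanoPairs j).map (disjSumEmbedding _ _)) where
  card_eq := by
    simp only [mem_map]
    rintro _ ⟨⟨L, T⟩, hP, rfl⟩
    have hQ : #({0, 1, 2, 3} : Finset (Fin 7)) = 4 := by decide
    simp only [fanoPairs, mem_union, mem_product, mem_filter, mem_univ, true_and,
      mem_singleton] at hP
    change #(L.disjSum T) = j + 3
    rw [card_disjSum]
    rcases hP with ⟨h, hT⟩ | ⟨rfl, hT⟩
    · rw [card_of_mem_fanoLines L h, hT, add_comm]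
    · omega
  inter_nonempty := by
    have hfst : ∀ P ∈ fanoPairs j, P.1 ∈ insert {0, 1, 2, 3} fanoLines := by
      intro P hP
      simp only [fanoPairs, mem_union, mem_product, mem_singleton] at hP
      rw [mem_insert]
      tauto
    simp only [mem_map]
    rintro _ ⟨P, hP, rfl⟩ _ ⟨R, hR, rfl⟩
    obtain ⟨x, hx⟩ :=
      inter_nonempty_of_mem_insert_fanoLines _ (hfst P hP) _ (hfst R hR)
    rw [mem_inter] at hx
    exact ⟨Sum.inl x, by simpa [disjSumEmbedding_apply] using hx⟩
  card_lt := by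
    rintro (x | y)
    · rw [filter_map, card_map, card_map]
      convert card_fanoPairs_lt_fst j x using 5
      simp [disjSumEmbedding_apply]
    · rw [filter_map, card_map, card_map]
      convert card_fanoPairs_lt_snd j y using 5
      simp [disjSumEmbedding_apply]

/-- For every `k ≥ 3` there is an intersecting family `𝓕 ⊆ 2^[2k+1]` with
`div(𝓕) > ∑_{i=k+1}^{2k} C(2k,i)`, disproving Huang's conjecture. -/
theorem huang_conjecture_false (k : ℕ) (hk : 3 ≤ k) :
    ∃ 𝓕 : Finset (Finset (Fin (2 * k + 1))),
      (∀ A ∈ 𝓕, ∀ B ∈ 𝓕, (A ∩ B).Nonempty) ∧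
      (∑ i ∈ Finset.Icc (k + 1) (2 * k), (2 * k).choose i) < diversity 𝓕 := by
  obtain ⟨j, rfl⟩ := Nat.exists_eq_add_of_le' hk
  have e : Fin 7 ⊕ Fin (2 * j) ≃ Fin (2 * (j + 3) + 1) :=
    finSumFinEquiv.trans (finCongr (by omega))
  have h := (isSparseIntersecting_fanoPairs j).map e
  have hV := Fintype.card_fin (2 * (j + 3) + 1)
  exact ⟨_, h.majoritySwap_inter_nonempty hV,
    (lt_diversity_iff _).2 fun x => h.lt_card_majoritySwap hV x⟩
end

section
/- Let k ≥ 1 and n = 2k+1. Let 𝓐 ⊆ 2^[n] be an intersecting family such that every member of 𝓐 has size at most k, and such that 𝓐 is closed under taking supersets of size at most k (i.e., if A ∈ 𝓐, A ⊆ B ⊆ [n] and |B| ≤ k, then B ∈ 𝓐). Then the family 𝓡 = 𝓐 ∪ (𝓠_k \ 𝓐̄), where 𝓐̄ = {[n]\A : A ∈ 𝓐}, is intersecting. -/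
/-- `𝓠_k = {A ⊆ [2k+1] : |A| ≥ k+1}`. -/
def Qfam (k : ℕ) : Finset (Finset (Fin (2 * k + 1))) :=
  Finset.univ.filter (fun A => k + 1 ≤ A.card)

/-- The family `𝓕̄` of complements of members of `𝓕`. -/
def compls {n : ℕ} (𝓕 : Finset (Finset (Fin n))) : Finset (Finset (Fin n)) :=
  𝓕.image (fun A => Aᶜ)

/-- Let `k ≥ 1` and let `𝓐 ⊆ 2^[2k+1]` be an intersecting family whose members have size
at most `k` and which is closed under taking supersets of size at most `k`.  Then
`𝓡 = 𝓐 ∪ (𝓠_k \ 𝓐̄)` is intersecting. -/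
theorem union_intersecting_upset (k : ℕ) (hk : 1 ≤ k) (𝓐 : Finset (Finset (Fin (2 * k + 1))))
    (hcard : ∀ A ∈ 𝓐, A.card ≤ k) (hint : ∀ A ∈ 𝓐, ∀ B ∈ 𝓐, (A ∩ B).Nonempty)
    (hup : ∀ A ∈ 𝓐, ∀ B : Finset (Fin (2 * k + 1)), A ⊆ B → B.card ≤ k → B ∈ 𝓐) :
    ∀ A ∈ 𝓐 ∪ (Qfam k \ compls 𝓐), ∀ B ∈ 𝓐 ∪ (Qfam k \ compls 𝓐), (A ∩ B).Nonempty := by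
  have mixed : ∀ A ∈ 𝓐, ∀ B ∈ Qfam k \ compls 𝓐, (A ∩ B).Nonempty := by
    intro A hA B hB
    simp only [Qfam, compls, Finset.mem_sdiff, Finset.mem_filter, Finset.mem_univ, true_and,
      Finset.mem_image, not_exists, not_and] at hB
    by_contra h
    have hdisj : Disjoint A B :=
      Finset.disjoint_iff_inter_eq_empty.mpr (Finset.not_nonempty_iff_eq_empty.mp h)
    have hcompl : Bᶜ.card ≤ k := by
      rw [Finset.card_compl, Fintype.card_fin]
      omega
    exact hB.2 Bᶜ (hup A hA Bᶜ (Finset.subset_compl_iff_disjoint_right.mpr hdisj) hcompl)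
      (compl_compl B)
  intro A hA B hB
  rcases Finset.mem_union.mp hA with hA | hA <;> rcases Finset.mem_union.mp hB with hB | hB
  · exact hint A hA B hB
  · exact mixed A hA B hB
  · rw [Finset.inter_comm]
    exact mixed B hB A hA
  · have hAcard : k + 1 ≤ A.card := (Finset.mem_filter.mp (Finset.mem_sdiff.mp hA).1).2
    have hBcard : k + 1 ≤ B.card := (Finset.mem_filter.mp (Finset.mem_sdiff.mp hB).1).2
    have hunion := Finset.card_le_univ (A ∪ B)
    rw [Fintype.card_fin] at hunion
    have hsum := Finset.card_union_add_card_inter A B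
    exact Finset.card_pos.mp (by omega)
end

section
/- Let q ≥ 3 be odd, n = q²+q+1 and k = (q²+q)/2. Then for every i with q+1 < i ≤ k, n·C(n−q−1, i−q−1) − C(n,2)·C(n−2q−1, i−2q−1) ≥ (n/2)·C(n−q−1, i−q−1). -/
/-- The binomial coefficient `C(m, j)` with an integer lower index, with the convention
`C(m, j) = 0` for `j < 0` (and, as usual, `C(m, j) = 0` for `j > m`). -/
def chooseZ (m : ℕ) (j : ℤ) : ℕ := if 0 ≤ j then m.choose j.toNat else 0

theorem two_pow_mul_choose_le (m j r : ℕ) (h : 2 * (j + r) ≤ m + r) :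
    2 ^ r * m.choose j ≤ (m + r).choose (j + r) := by
  induction r with
  | zero => simp
  | succ r ih =>
    have ih := ih (by omega)
    have e := Nat.add_one_mul_choose_eq (m + r) (j + r)
    have h2 : 2 * (m + r).choose (j + r) ≤ (m + r + 1).choose (j + r + 1) := by
      refine Nat.le_of_mul_le_mul_right ?_ (Nat.succ_pos (j + r))
      rw [Nat.succ_eq_add_one, ← e]
      calc 2 * (m + r).choose (j + r) * (j + r + 1)
          = (2 * (j + r + 1)) * (m + r).choose (j + r) := by ring
        _ ≤ (m + r + 1) * (m + r).choose (j + r) := Nat.mul_le_mul_right _ (by omega)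
    rw [pow_succ]
    change _ ≤ (m + r + 1).choose (j + r + 1)
    linarith

theorem sq_add_self_le_two_pow (q : ℕ) (hq : 5 ≤ q) : q ^ 2 + q ≤ 2 ^ q := by
  induction q, hq using Nat.le_induction with
  | base => norm_num
  | succ q hq ih =>
    rw [pow_succ 2 q]
    nlinarith

/-- For odd `q ≥ 3`, `n = q²+q+1`, `k = (q²+q)/2`, and every `i` with `q+1 < i ≤ k`,
`n·C(n−q−1, i−q−1) − C(n,2)·C(n−2q−1, i−2q−1) ≥ (n/2)·C(n−q−1, i−q−1)`. -/
theorem bonferroni_half_bound (q : ℕ) (hq3 : 3 ≤ q) (hq : Odd q)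
    (n k : ℕ) (hn : n = q ^ 2 + q + 1) (hk : k = (q ^ 2 + q) / 2)
    (i : ℕ) (hi1 : q + 1 < i) (hi2 : i ≤ k) :
    (n : ℚ) * (n - q - 1).choose (i - q - 1) -
        (n.choose 2 : ℚ) * chooseZ (n - 2 * q - 1) ((i : ℤ) - 2 * q - 1) ≥
      ((n : ℚ) / 2) * (n - q - 1).choose (i - q - 1) := by
  have key : (q ^ 2 + q) * chooseZ (n - 2 * q - 1) ((i : ℤ) - 2 * q - 1) ≤
      (n - q - 1).choose (i - q - 1) := by
    unfold chooseZ
    split_ifs with h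
    · obtain ⟨j, rfl⟩ : ∃ j, i = 2 * q + 1 + j := ⟨i - (2 * q + 1), by omega⟩
      have hq5 : 5 ≤ q := by
        obtain ⟨a, rfl⟩ := hq
        by_contra hlt
        obtain rfl : a = 1 := by omega
        norm_num at hk
        omega
      obtain ⟨m, hm⟩ : ∃ m, q ^ 2 = m + q := ⟨q ^ 2 - q, by
        have : q ≤ q ^ 2 := Nat.le_self_pow (by norm_num) q
        omega⟩
      have e1 : n - 2 * q - 1 = m := by omega
      have e2 : ((2 * q + 1 + j : ℕ) - 2 * q - 1 : ℤ).toNat = j := by omega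
      have e3 : n - q - 1 = m + q := by omega
      have e4 : 2 * q + 1 + j - q - 1 = j + q := by omega
      rw [e1, e2, e3, e4]
      exact (Nat.mul_le_mul_right _ (sq_add_self_le_two_pow q hq5)).trans
        (two_pow_mul_choose_le m j q (by omega))
    · simp
  have hn' : (n : ℚ) = q ^ 2 + q + 1 := by rw [hn]; push_cast; ring
  have key' : ((n : ℚ) - 1) * chooseZ (n - 2 * q - 1) ((i : ℤ) - 2 * q - 1) ≤
      (n - q - 1).choose (i - q - 1) := by
    rw [hn', add_sub_cancel_right]
    exact_mod_cast key
  have hmul := mul_le_mul_of_nonneg_left key' (by positivity : (0 : ℚ) ≤ (n : ℚ) / 2)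
  rw [Nat.cast_choose_two]
  linarith
end

section
/- Let q be an odd prime power, n = q²+q+1, k = (q²+q)/2, and identify the points of the projective plane P²(F_q) with [n]. For q+1 ≤ i ≤ k, let 𝓐_i be the family of all i-element subsets of points containing a line, let 𝓐 = ⋃_{i=q+1}^{k} 𝓐_i, and let 𝓡_k = 𝓐 ∪ (𝓠_k \ 𝓐̄), where 𝓠_k = {A ⊆ [n] : |A| ≥ k+1} and 𝓐̄ = {[n]\A : A ∈ 𝓐}. Then 𝓡_k is an intersecting family. -/
open scoped LinearAlgebra.Projectivization

open Classical in
/-- The family `𝓐_i` of all `i`-element subsets of the points of the projective plane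
`ℙ F (Fin 3 → F)` that contain (all the points of) a line, a line being the set of points
lying in a 2-dimensional linear subspace of `F³`. -/
noncomputable def famA (F : Type) [Field F]
    [Fintype (ℙ F (Fin 3 → F))] (i : ℕ) :
    Finset (Finset (ℙ F (Fin 3 → F))) :=
  Finset.univ.filter (fun A : Finset (ℙ F (Fin 3 → F)) =>
    A.card = i ∧ ∃ W : Submodule F (Fin 3 → F), Module.finrank F W = 2 ∧
      ∀ p : ℙ F (Fin 3 → F), p.submodule ≤ W → p ∈ A)

/-- `𝓐 = ⋃_{i=q+1}^{k} 𝓐_i`. -/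
noncomputable def famAU (F : Type) [Field F] [Fintype F]
    [Fintype (ℙ F (Fin 3 → F))] [DecidableEq (ℙ F (Fin 3 → F))] (k : ℕ) :
    Finset (Finset (ℙ F (Fin 3 → F))) :=
  (Finset.Icc (Fintype.card F + 1) k).biUnion (famA F)

/-- `𝓠_k = {A ⊆ P : |A| ≥ k+1}` for a finite point set `P`. -/
def QfamP (P : Type) [Fintype P] (k : ℕ) : Finset (Finset P) :=
  Finset.univ.filter (fun A => k + 1 ≤ A.card)

/-- The family `𝓕̄` of complements of members of `𝓕`. -/
def complsP {P : Type} [Fintype P] [DecidableEq P] (𝓕 : Finset (Finset P)) :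
    Finset (Finset P) :=
  𝓕.image (fun A => Aᶜ)

/-- `𝓡_k = 𝓐 ∪ (𝓠_k \ 𝓐̄)`. -/
noncomputable def famR (F : Type) [Field F] [Fintype F]
    [Fintype (ℙ F (Fin 3 → F))] [DecidableEq (ℙ F (Fin 3 → F))] (k : ℕ) :
    Finset (Finset (ℙ F (Fin 3 → F))) :=
  famAU F k ∪ (QfamP (ℙ F (Fin 3 → F)) k \ complsP (famAU F k))

theorem exists_projectivization_le_of_finrank_lt {K V : Type*} [DivisionRing K] [AddCommGroup V]
    [Module K V] [FiniteDimensional K V] {W₁ W₂ : Submodule K V}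
    (h : Module.finrank K V < Module.finrank K W₁ + Module.finrank K W₂) :
    ∃ p : ℙ K V, p.submodule ≤ W₁ ∧ p.submodule ≤ W₂ := by
  have hne : W₁ ⊓ W₂ ≠ ⊥ := by
    intro hbot
    have hsum := Submodule.finrank_sup_add_finrank_inf_eq W₁ W₂
    rw [hbot, finrank_bot] at hsum
    have hle := Submodule.finrank_le (W₁ ⊔ W₂)
    omega
  obtain ⟨v, hv, hv0⟩ := Submodule.exists_mem_ne_zero_of_ne_bot hne
  refine ⟨Projectivization.mk K v hv0, ?_, ?_⟩ <;>
    rw [Projectivization.submodule_mk, Submodule.span_singleton_le_iff_mem]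
  exacts [hv.1, hv.2]

theorem mem_famAU {F : Type} [Field F] [Fintype F] [Fintype (ℙ F (Fin 3 → F))]
    [DecidableEq (ℙ F (Fin 3 → F))] {k : ℕ} {A : Finset (ℙ F (Fin 3 → F))} :
    A ∈ famAU F k ↔ (Fintype.card F + 1 ≤ A.card ∧ A.card ≤ k) ∧
      ∃ W : Submodule F (Fin 3 → F), Module.finrank F W = 2 ∧
        ∀ p : ℙ F (Fin 3 → F), p.submodule ≤ W → p ∈ A := by
  simp [famAU, famA]

theorem inter_nonempty_of_mem_famAU {F : Type} [Field F] [Fintype F]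
    [Fintype (ℙ F (Fin 3 → F))] [DecidableEq (ℙ F (Fin 3 → F))] {k : ℕ}
    {A B : Finset (ℙ F (Fin 3 → F))} (hA : A ∈ famAU F k) (hB : B ∈ famAU F k) :
    (A ∩ B).Nonempty := by
  obtain ⟨-, W₁, hW₁, hA⟩ := mem_famAU.1 hA
  obtain ⟨-, W₂, hW₂, hB⟩ := mem_famAU.1 hB
  obtain ⟨p, hp₁, hp₂⟩ := exists_projectivization_le_of_finrank_lt (W₁ := W₁) (W₂ := W₂)
    (by rw [hW₁, hW₂, Module.finrank_fin_fun]; norm_num)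
  exact ⟨p, Finset.mem_inter.2 ⟨hA p hp₁, hB p hp₂⟩⟩

theorem inter_nonempty_of_mem_famAU_of_notMem_complsP {F : Type} [Field F] [Fintype F]
    [Fintype (ℙ F (Fin 3 → F))] [DecidableEq (ℙ F (Fin 3 → F))] {k : ℕ}
    {A B : Finset (ℙ F (Fin 3 → F))} (hA : A ∈ famAU F k) (hB : Bᶜ.card ≤ k)
    (hB' : B ∉ complsP (famAU F k)) :
    (A ∩ B).Nonempty := by
  rw [Finset.nonempty_iff_ne_empty, Ne, ← Finset.disjoint_iff_inter_eq_empty]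
  intro hdisj
  have hsub : A ⊆ Bᶜ := Finset.subset_compl_iff_disjoint_right.2 hdisj
  obtain ⟨⟨hq, -⟩, W, hW, hA⟩ := mem_famAU.1 hA
  exact hB' (Finset.mem_image.2 ⟨Bᶜ, mem_famAU.2
    ⟨⟨hq.trans (Finset.card_le_card hsub), hB⟩, W, hW, fun p hp => hsub (hA p hp)⟩,
    compl_compl B⟩)

/-- Let `q` be an odd prime power, `k = (q²+q)/2`.  Then the family
`𝓡_k = 𝓐 ∪ (𝓠_k \ 𝓐̄)` built from the projective plane over `F_q` is intersecting. -/
theorem famR_intersecting (q : ℕ) (hq : Odd q)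
    (hpp : ∃ p m : ℕ, p.Prime ∧ 0 < m ∧ q = p ^ m)
    (F : Type) [Field F] [Fintype F] (hF : Fintype.card F = q)
    [Fintype (ℙ F (Fin 3 → F))] [DecidableEq (ℙ F (Fin 3 → F))]
    (k : ℕ) (hk : k = (q ^ 2 + q) / 2) :
    ∀ A ∈ famR F k, ∀ B ∈ famR F k, (A ∩ B).Nonempty := by
  have hcard : Fintype.card (ℙ F (Fin 3 → F)) = 2 * k + 1 := by
    have h := Projectivization.card_of_finrank F (Fin 3 → F) (Module.finrank_fin_fun F (n := 3))
    simp only [Nat.card_eq_fintype_card, hF, Finset.sum_range_succ, Finset.sum_range_zero] at h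
    have heven : Even (q ^ 2 + q) := hq.pow.add_odd hq
    have := Nat.two_mul_div_two_of_even heven
    rw [h, hk, this]
    ring
  have hcompl {B : Finset (ℙ F (Fin 3 → F))} (hB : B ∈ QfamP (ℙ F (Fin 3 → F)) k) :
      Bᶜ.card ≤ k := by
    have hB := (Finset.mem_filter.1 hB).2
    rw [Finset.card_compl, hcard]
    omega
  intro A hA B hB
  rcases Finset.mem_union.1 hA with hA | hA <;> rcases Finset.mem_union.1 hB with hB | hB
  · exact inter_nonempty_of_mem_famAU hA hB
  · obtain ⟨hBQ, hB⟩ := Finset.mem_sdiff.1 hB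
    exact inter_nonempty_of_mem_famAU_of_notMem_complsP hA (hcompl hBQ) hB
  · obtain ⟨hAQ, hA⟩ := Finset.mem_sdiff.1 hA
    rw [Finset.inter_comm]
    exact inter_nonempty_of_mem_famAU_of_notMem_complsP hB (hcompl hAQ) hA
  · have hA := (Finset.mem_filter.1 (Finset.mem_sdiff.1 hA).1).2
    have hB := (Finset.mem_filter.1 (Finset.mem_sdiff.1 hB).1).2
    refine Finset.inter_nonempty_of_card_lt_card_add_card (Finset.subset_univ A)
      (Finset.subset_univ B) ?_
    rw [Finset.card_univ, hcard]
    omega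
end

section
/- Let q be an odd prime power, n = q²+q+1, k = (q²+q)/2, and identify the points of the projective plane P²(F_q) with [n]. For q+1 ≤ i ≤ k let 𝓐_i be the family of all i-element subsets of points containing a line, 𝓐 = ⋃_{i=q+1}^{k} 𝓐_i, 𝓠_k = {A ⊆ [n] : |A| ≥ k+1}, and 𝓡_k = 𝓐 ∪ (𝓠_k \ 𝓐̄), where 𝓐̄ = {[n]\A : A ∈ 𝓐}. Then div(𝓡_k) − div(𝓠_k) > ∑_{i=q+1}^{k} ((n−2i)/2)·C(n−q−1, i−q−1). -/
open scoped LinearAlgebra.Projectivization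

/-- The diversity `div(𝓕) = |𝓕| - max_{x ∈ P} |𝓕(x)|` of a family of subsets of a finite
point set `P`. -/
noncomputable def diversityP {P : Type} [Fintype P] [DecidableEq P]
    (𝓕 : Finset (Finset P)) : ℕ :=
  𝓕.card - Finset.univ.sup (fun x : P => (𝓕.filter (fun A => x ∈ A)).card)

open Finset

section Diversity

variable {P : Type} [Fintype P] [DecidableEq P]

/-- If the symmetries of `𝓕` act transitively on the points, then all points have the same degree
and the diversity is the average number of members of `𝓕` avoiding a point. -/
lemma card_mul_diversityP (𝓕 : Finset (Finset P))
    (h : ∀ x y : P, ∃ σ : Equiv.Perm P, σ x = y ∧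
      ∀ A, A.map σ.toEmbedding ∈ 𝓕 ↔ A ∈ 𝓕) :
    Fintype.card P * diversityP 𝓕 = ∑ A ∈ 𝓕, Aᶜ.card := by
  have hle : ∀ x y : P,
      (𝓕.filter (fun A => x ∈ A)).card ≤ (𝓕.filter (fun A => y ∈ A)).card := by
    intro x y
    obtain ⟨σ, hσ, hinv⟩ := h x y
    refine card_le_card_of_injOn (fun A => A.map σ.toEmbedding) ?_
      (Finset.map_injective _).injOn
    intro A hA
    simp only [coe_filter, Set.mem_ofPred_eq] at hA ⊢
    exact ⟨(hinv A).2 hA.1, mem_map.2 ⟨x, hA.2, hσ⟩⟩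
  have hpt : ∀ x : P, diversityP 𝓕 = (𝓕.filter (fun A => x ∉ A)).card := by
    intro x
    have hsup : univ.sup (fun y : P => (𝓕.filter (fun A => y ∈ A)).card)
        = (𝓕.filter (fun A => x ∈ A)).card :=
      le_antisymm (Finset.sup_le fun y _ => hle y x)
        (Finset.le_sup (f := fun y : P => (𝓕.filter (fun A => y ∈ A)).card) (mem_univ x))
    have := card_filter_add_card_filter_not (s := 𝓕) (fun A => x ∈ A)
    rw [diversityP, hsup]
    omega
  have hsum : ∑ x : P, (𝓕.filter (fun A => x ∉ A)).card = ∑ A ∈ 𝓕, Aᶜ.card := by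
    refine (sum_card_bipartiteAbove_eq_sum_card_bipartiteBelow
      (s := 𝓕) (t := univ) (fun A x => x ∉ A)).symm.trans ?_
    refine sum_congr rfl fun A _ => congrArg card ?_
    ext x
    simp [bipartiteAbove]
  rw [← hsum, ← sum_congr rfl fun x _ => hpt x]
  simp

lemma mem_complsP {𝓕 : Finset (Finset P)} {A : Finset P} : A ∈ complsP 𝓕 ↔ Aᶜ ∈ 𝓕 := by
  simp only [complsP, mem_image]
  exact ⟨by rintro ⟨B, hB, rfl⟩; simpa, fun h => ⟨_, h, compl_compl A⟩⟩

/-- Exchanging a family of small sets with its complements, starting from all sets of size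
more than half. -/
lemma card_mul_diversityP_swap (k : ℕ) (hk : Fintype.card P = 2 * k + 1)
    (𝓐 : Finset (Finset P)) (hsmall : ∀ A ∈ 𝓐, A.card ≤ k)
    (h : ∀ x y : P, ∃ σ : Equiv.Perm P, σ x = y ∧
      ∀ A, A.map σ.toEmbedding ∈ 𝓐 ↔ A ∈ 𝓐) :
    (Fintype.card P : ℚ) *
        ((diversityP (𝓐 ∪ (QfamP P k \ complsP 𝓐)) : ℚ) - diversityP (QfamP P k)) =
      ∑ A ∈ 𝓐, ((Fintype.card P : ℚ) - 2 * A.card) := by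
  have hQ := card_mul_diversityP (QfamP P k) fun x y => by
    obtain ⟨σ, hσ, -⟩ := h x y
    exact ⟨σ, hσ, fun A => by simp [QfamP]⟩
  have hR := card_mul_diversityP (𝓐 ∪ (QfamP P k \ complsP 𝓐)) fun x y => by
    obtain ⟨σ, hσ, hinv⟩ := h x y
    refine ⟨σ, hσ, fun A => ?_⟩
    have hc : (A.map σ.toEmbedding)ᶜ = Aᶜ.map σ.toEmbedding := by
      ext z; simp
    simp only [mem_union, mem_sdiff, mem_complsP, hc, hinv]
    simp [QfamP]
  have hsub : complsP 𝓐 ⊆ QfamP P k := by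
    intro A hA
    have := hsmall _ (mem_complsP.1 hA)
    rw [card_compl] at this
    simp only [QfamP, mem_filter, mem_univ, true_and]
    omega
  have hdisj : Disjoint 𝓐 (QfamP P k \ complsP 𝓐) := by
    rw [Finset.disjoint_left]
    intro A hA hA'
    have := hsmall _ hA
    simp only [QfamP, mem_sdiff, mem_filter, mem_univ, true_and] at hA'
    omega
  have hcompl : ∑ A ∈ complsP 𝓐, Aᶜ.card = ∑ A ∈ 𝓐, A.card := by
    rw [complsP, sum_image fun _ _ _ _ h => compl_injective h]
    simp
  rw [sum_union hdisj] at hR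
  have hsd := sum_sdiff (f := fun A : Finset P => Aᶜ.card) hsub
  rw [hcompl] at hsd
  have hcard : ∀ A : Finset P, (Aᶜ.card : ℚ) = Fintype.card P - A.card := fun A => by
    rw [card_compl, Nat.cast_sub (card_le_univ A)]
  have hA : ∑ A ∈ 𝓐, ((Fintype.card P : ℚ) - 2 * A.card) =
      ((∑ A ∈ 𝓐, Aᶜ.card : ℕ) : ℚ) - ((∑ A ∈ 𝓐, A.card : ℕ) : ℚ) := by
    push_cast
    rw [← sum_sub_distrib]
    exact sum_congr rfl fun A _ => by rw [hcard]; ring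
  rw [hA, mul_sub]
  have hQ' := congrArg (Nat.cast (R := ℚ)) hQ
  have hR' := congrArg (Nat.cast (R := ℚ)) hR
  have hsd' := congrArg (Nat.cast (R := ℚ)) hsd
  simp only [Nat.cast_mul, Nat.cast_add] at hQ' hR' hsd'
  linarith

end Diversity

section SupersetCounting

lemma two_pow_mul_choose_sub_le (m : ℕ) :
    ∀ t j : ℕ, 2 * j ≤ m → t ≤ j → 2 ^ t * (m - t).choose (j - t) ≤ m.choose j := by
  induction m with
  | zero =>
    intro t j hj ht
    obtain rfl : j = 0 := by omega
    obtain rfl : t = 0 := by omega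
    simp
  | succ m ih =>
    rintro (_ | t) (_ | j) hj ht
    · simp
    · simp
    · omega
    · rw [Nat.succ_sub_succ, Nat.succ_sub_succ, pow_succ]
      have h1 := ih t j (by omega) (by omega)
      have h2 := Nat.add_one_mul_choose_eq m j
      have h3 : 2 * m.choose j ≤ (m + 1).choose (j + 1) := by
        refine Nat.le_of_mul_le_mul_right ?_ (Nat.succ_pos j)
        rw [← h2]
        nlinarith [Nat.zero_le (m.choose j)]
      nlinarith

lemma sq_add_self_lt_two_pow (q : ℕ) (hq : 5 ≤ q) : q ^ 2 + q < 2 ^ q := by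
  induction q, hq using Nat.le_induction with
  | base => norm_num
  | succ n hn ih => rw [pow_succ 2]; nlinarith

variable {P L : Type*} [Fintype P] [DecidableEq P] [Fintype L]

lemma card_supersets (S : Finset P) (i : ℕ) (h : S.card ≤ i) :
    (univ.filter fun A : Finset P => A.card = i ∧ S ⊆ A).card =
      (Fintype.card P - S.card).choose (i - S.card) := by
  rw [← card_univ, ← card_filter_powersetCard_subset S univ i (subset_univ S) h]
  congr 1
  ext A
  simp

lemma supersets_eq_empty (S : Finset P) (i : ℕ) (h : i < S.card) :
    (univ.filter fun A : Finset P => A.card = i ∧ S ⊆ A) = ∅ :=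
  filter_eq_empty_iff.2 fun A _ hA => by
    have := card_le_card hA.2
    omega

/-- A Bonferroni inequality for the number of `i`-sets containing a block. -/
lemma three_mul_sum_card_supersets_le (ℓ : L → Finset P) (i : ℕ) :
    3 * ∑ w, (univ.filter fun A : Finset P => A.card = i ∧ ℓ w ⊆ A).card ≤
      2 * (univ.filter fun A : Finset P => A.card = i ∧ ∃ w, ℓ w ⊆ A).card +
      ∑ w, ∑ w', (univ.filter fun A : Finset P => A.card = i ∧ ℓ w ∪ ℓ w' ⊆ A).card := by
  let N : Finset P → ℕ := fun A => (univ.filter fun w => ℓ w ⊆ A).card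
  have h1 : ∑ w, (univ.filter fun A : Finset P => A.card = i ∧ ℓ w ⊆ A).card =
      ∑ A ∈ univ.filter fun A : Finset P => A.card = i, N A := by
    simp only [N, card_filter, sum_filter]
    rw [sum_comm]
    refine sum_congr rfl fun A _ => ?_
    by_cases h : A.card = i <;> simp [h]
  have h2 : ∑ w, ∑ w', (univ.filter fun A : Finset P => A.card = i ∧ ℓ w ∪ ℓ w' ⊆ A).card =
      ∑ A ∈ univ.filter fun A : Finset P => A.card = i, N A * N A := by
    simp only [N, card_filter, sum_filter, union_subset_iff, sum_mul_sum]
    simp_rw [sum_comm (s := (univ : Finset L)) (t := (univ : Finset (Finset P)))]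
    refine sum_congr rfl fun A _ => ?_
    by_cases h : A.card = i
    · simp only [h, true_and, if_true]
      refine sum_congr rfl fun w _ => sum_congr rfl fun w' _ => ?_
      by_cases h1 : ℓ w ⊆ A <;> by_cases h2 : ℓ w' ⊆ A <;> simp [h1, h2]
    · simp [h]
  have h3 : (univ.filter fun A : Finset P => A.card = i ∧ ∃ w, ℓ w ⊆ A).card =
      ∑ A ∈ univ.filter fun A : Finset P => A.card = i, if ∃ w, ℓ w ⊆ A then 1 else 0 := by
    rw [← card_filter, filter_filter]
  rw [h1, h2, h3, mul_sum, mul_sum, ← sum_add_distrib]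
  refine sum_le_sum fun A _ => ?_
  split_ifs with h
  · obtain h0 | h0 | h0 : N A ≤ 1 ∨ N A = 2 ∨ 3 ≤ N A := by omega
    · interval_cases N A <;> simp
    · norm_num [h0]
    · nlinarith
  · have : N A = 0 := by
      simp only [N, card_eq_zero, filter_eq_empty_iff]
      exact fun w _ hw => h ⟨w, hw⟩
    simp [this]

/-- In a configuration with the parameters of a projective plane of odd order `q`, the number of
`i`-sets containing a line is more than half the number of pairs of a line and an `i`-set
containing it. -/
lemma card_mul_choose_lt_two_mul_card [DecidableEq L] (q : ℕ) (hq : Odd q) (hq3 : 3 ≤ q)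
    (ℓ : L → Finset P)
    (hP : Fintype.card P = q ^ 2 + q + 1) (hL : Fintype.card L = q ^ 2 + q + 1)
    (hℓ : ∀ w, (ℓ w).card = q + 1) (hinter : ∀ w w', w ≠ w' → (ℓ w ∩ ℓ w').card = 1)
    (i : ℕ) (hi : q + 1 ≤ i) (hik : 2 * i ≤ q ^ 2 + q) :
    (q ^ 2 + q + 1) * (q ^ 2).choose (i - q - 1) <
      2 * (univ.filter fun A : Finset P => A.card = i ∧ ∃ w, ℓ w ⊆ A).card := by
  set C := (q ^ 2).choose (i - q - 1) with hC
  have hCpos : 0 < C := Nat.choose_pos (by omega)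
  have h1 : ∀ w, (univ.filter fun A : Finset P => A.card = i ∧ ℓ w ⊆ A).card = C := by
    intro w
    rw [card_supersets _ _ (by rw [hℓ]; exact hi), hℓ, hP, hC]
    congr 1; omega
  have hunion : ∀ w w', w ≠ w' → (ℓ w ∪ ℓ w').card = 2 * q + 1 := by
    intro w w' hw
    have := card_union_add_card_inter (ℓ w) (ℓ w')
    rw [hℓ, hℓ, hinter w w' hw] at this
    omega
  have h2 : ∀ w w', w ≠ w' → (q ^ 2 + q) *
      (univ.filter fun A : Finset P => A.card = i ∧ ℓ w ∪ ℓ w' ⊆ A).card < C := by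
    intro w w' hw
    rcases lt_or_ge i (2 * q + 1) with hlt | hge
    · rw [supersets_eq_empty _ _ (by rw [hunion w w' hw]; exact hlt)]
      simpa using hCpos
    · have hq5 : 5 ≤ q := by
        obtain ⟨r, rfl⟩ := hq
        by_contra hcon
        obtain rfl : r = 1 := by omega
        omega
      rw [card_supersets _ _ (by rw [hunion w w' hw]; exact hge), hunion w w' hw, hP]
      have hb := two_pow_mul_choose_sub_le (q ^ 2) q (i - q - 1) (by omega) (by omega)
      have e1 : q ^ 2 + q + 1 - (2 * q + 1) = q ^ 2 - q := by omega
      have e2 : i - (2 * q + 1) = i - q - 1 - q := by omega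
      rw [e1, e2]
      refine lt_of_lt_of_le ?_ hb
      have hqq : q ≤ q ^ 2 := by nlinarith
      exact Nat.mul_lt_mul_of_pos_right (sq_add_self_lt_two_pow q hq5)
        (Nat.choose_pos (by omega))
  have h3 : ∀ w, ∑ w', (univ.filter fun A : Finset P => A.card = i ∧ ℓ w ∪ ℓ w' ⊆ A).card
      < 2 * C := by
    intro w
    rw [← add_sum_erase _ _ (mem_univ w), union_self, h1, two_mul]
    refine Nat.add_lt_add_left ?_ C
    have hcard : (univ.erase w).card = q ^ 2 + q := by
      rw [card_erase_of_mem (mem_univ w), card_univ, hL]; rfl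
    have hne : (univ.erase w).Nonempty := by
      rw [← card_pos, hcard]; positivity
    have := sum_lt_sum_of_nonempty hne fun w' hw' => h2 w w' (ne_of_mem_erase hw').symm
    rw [← mul_sum, sum_const, hcard, smul_eq_mul] at this
    exact Nat.lt_of_mul_lt_mul_left this
  have h4 : ∑ w, ∑ w', (univ.filter fun A : Finset P => A.card = i ∧ ℓ w ∪ ℓ w' ⊆ A).card
      < (q ^ 2 + q + 1) * (2 * C) := by
    rw [← hL, ← card_univ, ← smul_eq_mul, ← sum_const]
    refine sum_lt_sum_of_nonempty ?_ fun w _ => h3 w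
    rw [← card_pos, card_univ, hL]; positivity
  have h5 := three_mul_sum_card_supersets_le ℓ i
  rw [sum_congr rfl fun w _ => h1 w, sum_const, card_univ, hL, smul_eq_mul] at h5
  nlinarith

end SupersetCounting

section ProjectivePlane

open Projectivization

variable {F : Type} [Field F]

lemma submodule_smul_le_map_iff (g : (Fin 3 → F) ≃ₗ[F] (Fin 3 → F)) (p : ℙ F (Fin 3 → F))
    (W : Submodule F (Fin 3 → F)) :
    (g • p).submodule ≤ W.map (g : (Fin 3 → F) →ₗ[F] (Fin 3 → F)) ↔ p.submodule ≤ W := by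
  induction p using Projectivization.ind with
  | _ v hv =>
    rw [smul_mk, submodule_mk, submodule_mk, Submodule.span_singleton_le_iff_mem,
      Submodule.span_singleton_le_iff_mem]
    simp

lemma map_toPerm_mem_famA [Fintype (ℙ F (Fin 3 → F))] (i : ℕ)
    (g : (Fin 3 → F) ≃ₗ[F] (Fin 3 → F)) {A : Finset (ℙ F (Fin 3 → F))} (hA : A ∈ famA F i) :
    A.map (MulAction.toPerm g).toEmbedding ∈ famA F i := by
  simp only [famA, mem_filter, mem_univ, true_and, card_map] at hA ⊢
  obtain ⟨hc, W, hW, hWA⟩ := hA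
  refine ⟨hc, W.map (g : (Fin 3 → F) →ₗ[F] (Fin 3 → F)), ?_, fun p hp => ?_⟩
  · rw [← hW]; exact LinearEquiv.finrank_map_eq g W
  · rw [← smul_inv_smul g p, submodule_smul_le_map_iff] at hp
    exact mem_map.2 ⟨g⁻¹ • p, hWA _ hp, smul_inv_smul g p⟩

lemma map_toPerm_mem_famA_iff [Fintype (ℙ F (Fin 3 → F))] (i : ℕ)
    (g : (Fin 3 → F) ≃ₗ[F] (Fin 3 → F)) (A : Finset (ℙ F (Fin 3 → F))) :
    A.map (MulAction.toPerm g).toEmbedding ∈ famA F i ↔ A ∈ famA F i := by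
  refine ⟨fun h => ?_, map_toPerm_mem_famA i g⟩
  have := map_toPerm_mem_famA i g⁻¹ h
  rw [map_map] at this
  convert this
  ext x
  simp

lemma exists_perm_famAU_invariant [Fintype F] [Fintype (ℙ F (Fin 3 → F))]
    [DecidableEq (ℙ F (Fin 3 → F))] (k : ℕ) (x y : ℙ F (Fin 3 → F)) :
    ∃ σ : Equiv.Perm (ℙ F (Fin 3 → F)), σ x = y ∧
      ∀ A, A.map σ.toEmbedding ∈ famAU F k ↔ A ∈ famAU F k := by
  have : MulAction.IsPretransitive ((Fin 3 → F) ≃ₗ[F] (Fin 3 → F)) (ℙ F (Fin 3 → F)) :=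
    MulAction.isPretransitive_of_is_two_pretransitive
  obtain ⟨g, hg⟩ := MulAction.exists_smul_eq ((Fin 3 → F) ≃ₗ[F] (Fin 3 → F)) x y
  refine ⟨MulAction.toPerm g, hg, fun A => ?_⟩
  simp only [famAU, mem_biUnion, map_toPerm_mem_famA_iff]

lemma exists_submodule_le_iff_orthogonal (w : ℙ F (Fin 3 → F)) :
    ∃ W : Submodule F (Fin 3 → F), Module.finrank F W = 2 ∧
      ∀ p : ℙ F (Fin 3 → F), p.submodule ≤ W ↔ p.orthogonal w := by
  induction w using Projectivization.ind with
  | _ v hv =>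
    let φ : Module.Dual F (Fin 3 → F) := dotProductEquiv F (Fin 3) v
    have hφ : φ ≠ 0 := by simpa [φ] using hv
    refine ⟨LinearMap.ker φ, ?_, fun p => ?_⟩
    · have := Module.Dual.finrank_ker_add_one_of_ne_zero hφ
      simp at this
      omega
    · induction p using Projectivization.ind with
      | _ u hu =>
        rw [submodule_mk, Submodule.span_singleton_le_iff_mem, orthogonal_mk hu hv,
          dotProduct_comm]
        rfl

end ProjectivePlane

/-- Let `q` be an odd prime power, `n = q²+q+1`, `k = (q²+q)/2`.  For the family
`𝓡_k = 𝓐 ∪ (𝓠_k \ 𝓐̄)` built from the projective plane over `F_q`,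
`div(𝓡_k) − div(𝓠_k) > ∑_{i=q+1}^{k} ((n−2i)/2)·C(n−q−1, i−q−1)`. -/
theorem famR_diversity (q : ℕ) (hq : Odd q)
    (hpp : ∃ p m : ℕ, p.Prime ∧ 0 < m ∧ q = p ^ m)
    (F : Type) [Field F] [Fintype F] (hF : Fintype.card F = q)
    [Fintype (ℙ F (Fin 3 → F))] [DecidableEq (ℙ F (Fin 3 → F))]
    (n k : ℕ) (hn : n = q ^ 2 + q + 1) (hk : k = (q ^ 2 + q) / 2) :
    (diversityP (famR F k) : ℚ) - diversityP (QfamP (ℙ F (Fin 3 → F)) k) >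
      ∑ i ∈ Finset.Icc (q + 1) k,
        (((n : ℚ) - 2 * i) / 2) * (n - q - 1).choose (i - q - 1) := by
  classical
  subst hF hn hk
  set q := Fintype.card F with hqdef
  have hq3 : 3 ≤ q := by
    have : 1 < q := Fintype.one_lt_card
    obtain ⟨r, hr⟩ := hq
    omega
  have hP : Fintype.card (ℙ F (Fin 3 → F)) = q ^ 2 + q + 1 := by
    rw [← Nat.card_eq_fintype_card,
      Projectivization.card_of_finrank F (Fin 3 → F) (n := 3) (by simp), Nat.card_eq_fintype_card, ← hqdef]
    simp [sum_range_succ]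
    ring
  have hord : Configuration.ProjectivePlane.order (ℙ F (Fin 3 → F)) (ℙ F (Fin 3 → F)) = q := by
    have := Configuration.ProjectivePlane.card_points (ℙ F (Fin 3 → F)) (ℙ F (Fin 3 → F))
    rw [hP] at this
    nlinarith
  let ℓ : ℙ F (Fin 3 → F) → Finset (ℙ F (Fin 3 → F)) := fun w => univ.filter fun p => p ∈ w
  have hℓ : ∀ w, (ℓ w).card = q + 1 := by
    intro w
    have := Configuration.ProjectivePlane.pointCount_eq (ℙ F (Fin 3 → F)) w
    rw [hord, Configuration.pointCount, Nat.card_eq_fintype_card, Fintype.card_subtype] at this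
    exact this
  have hinter : ∀ w w', w ≠ w' → (ℓ w ∩ ℓ w').card = 1 := by
    intro w w' hw
    obtain ⟨p, hp, hu⟩ := Configuration.HasPoints.existsUnique_point (ℙ F (Fin 3 → F)) _ w w' hw
    refine card_eq_one.2 ⟨p, ?_⟩
    ext x
    simp only [ℓ, mem_inter, mem_filter, mem_univ, true_and, mem_singleton]
    exact ⟨hu x, by rintro rfl; exact hp⟩
  have heven : 2 * ((q ^ 2 + q) / 2) = q ^ 2 + q :=
    Nat.mul_div_cancel' (by rw [sq, ← Nat.mul_succ]; exact (Nat.even_mul_succ_self q).two_dvd)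
  set k := (q ^ 2 + q) / 2 with hk
  have hlarge : ∀ i ∈ Icc (q + 1) k,
      (q ^ 2 + q + 1) * (q ^ 2).choose (i - q - 1) < 2 * (famA F i).card := by
    intro i hi
    rw [mem_Icc] at hi
    refine (card_mul_choose_lt_two_mul_card q hq hq3 ℓ hP hP hℓ hinter i hi.1 (by omega)).trans_le
      (Nat.mul_le_mul_left 2 (card_le_card fun A hA => ?_))
    simp only [famA, mem_filter, mem_univ, true_and] at hA ⊢
    obtain ⟨hc, w, hw⟩ := hA
    obtain ⟨W, hW, hpW⟩ := exists_submodule_le_iff_orthogonal w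
    exact ⟨hc, W, hW, fun p hp => hw (mem_filter.2 ⟨mem_univ p, (hpW p).1 hp⟩)⟩
  have hcard : ∀ i, ∀ A ∈ famA F i, A.card = i := fun i A hA => by
    simp only [famA, mem_filter] at hA
    exact hA.2.1
  have hswap := card_mul_diversityP_swap k (by omega) (famAU F k) (fun A hA => by
    obtain ⟨i, hi, hA⟩ := mem_biUnion.1 hA
    rw [hcard i A hA]
    exact (mem_Icc.1 hi).2) (exists_perm_famAU_invariant k)
  have hsum : ∑ A ∈ famAU F k, ((Fintype.card (ℙ F (Fin 3 → F)) : ℚ) - 2 * A.card) =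
      ∑ i ∈ Icc (q + 1) k, ((q ^ 2 + q + 1 : ℕ) - 2 * i : ℚ) * (famA F i).card := by
    rw [famAU, sum_biUnion]
    · refine sum_congr rfl fun i _ => ?_
      rw [sum_congr rfl fun A hA => by rw [hcard i A hA, hP], sum_const, nsmul_eq_mul, mul_comm]
    · intro i _ j _ hij
      rw [Function.onFun, Finset.disjoint_left]
      exact fun A hi hj => hij ((hcard i A hi).symm.trans (hcard j A hj))
  rw [hsum, hP] at hswap
  rw [gt_iff_lt, famR]
  have hn0 : (0 : ℚ) < (q ^ 2 + q + 1 : ℕ) := by positivity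
  refine lt_of_mul_lt_mul_left ?_ hn0.le
  rw [hswap, mul_sum]
  refine sum_lt_sum_of_nonempty ⟨k, mem_Icc.2 ⟨by nlinarith, le_rfl⟩⟩ fun i hi => ?_
  have hl : (((q ^ 2 + q + 1) * (q ^ 2).choose (i - q - 1) : ℕ) : ℚ) <
      ((2 * (famA F i).card : ℕ) : ℚ) := Nat.cast_lt.2 (hlarge i hi)
  have hi2 : (0 : ℚ) < (q ^ 2 + q + 1 : ℕ) - 2 * i := by
    have : 2 * i < q ^ 2 + q + 1 := by
      have := (mem_Icc.1 hi).2
      omega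
    rw [sub_pos]
    exact_mod_cast this
  have e : q ^ 2 + q + 1 - q - 1 = q ^ 2 := by omega
  rw [e]
  rw [Nat.cast_mul, Nat.cast_mul] at hl
  have := mul_lt_mul_of_pos_left hl hi2
  push_cast at this ⊢
  linarith
end

section
/- Let k ≥ 1 and n = 2k+1. Let 𝓐 ⊆ 2^[n] be a family all of whose members have size at most k, such that both 𝓐 and 𝓐̄ = {[n]\A : A ∈ 𝓐} are regular, with common degrees σ(𝓐) and σ(𝓐̄) respectively, and let 𝓡 = 𝓐 ∪ (𝓠_k \ 𝓐̄) with 𝓠_k = {A ⊆ [n] : |A| ≥ k+1}. Then for every x ∈ [n], the number of members of 𝓡 containing x equals σ(𝓐) + σ(𝓠_k) − σ(𝓐̄), where σ(𝓠_k) = ∑_{i=k}^{2k} C(2k,i); consequently |𝓡| = |𝓠_k| and div(𝓡) = div(𝓠_k) + |𝓐| − 2σ(𝓐). -/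
/-- The degree of `x` in a family `𝓕`: the number of members of `𝓕` containing `x`. -/
def degree {n : ℕ} (𝓕 : Finset (Finset (Fin n))) (x : Fin n) : ℕ :=
  (𝓕.filter (fun A => x ∈ A)).card

theorem card_filter_le_card_powerset {α : Type*} (S : Finset α) (k : ℕ) :
    (S.powerset.filter (fun B => k ≤ B.card)).card = ∑ i ∈ Finset.Icc k S.card, S.card.choose i := by
  rw [Finset.card_eq_sum_card_fiberwise (f := Finset.card) (t := Finset.Icc k S.card)]
  · refine Finset.sum_congr rfl fun i hi => ?_
    rw [← Finset.card_powersetCard]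
    congr 1
    ext B
    simp only [Finset.mem_filter, Finset.mem_powerset, Finset.mem_powersetCard, Finset.mem_Icc]
      at hi ⊢
    grind
  · intro B hB
    simp only [Finset.coe_filter, Set.mem_ofPred_eq, Finset.mem_powerset, Finset.coe_Icc,
      Set.mem_Icc] at hB ⊢
    exact ⟨hB.2, Finset.card_le_card hB.1⟩

theorem degree_Qfam (k : ℕ) (x : Fin (2 * k + 1)) :
    degree (Qfam k) x = ∑ i ∈ Finset.Icc k (2 * k), (2 * k).choose i := by
  have hS : (Finset.univ.erase x).card = 2 * k := by simp
  have h := card_filter_le_card_powerset (Finset.univ.erase x) k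
  rw [hS] at h
  rw [← h, degree]
  refine Finset.card_nbij' (fun A => A.erase x) (fun B => insert x B) ?_ ?_ ?_ ?_
  · intro A hA
    simp only [Qfam, Finset.coe_filter, Finset.mem_filter, Finset.mem_univ, true_and,
      Set.mem_ofPred_eq, Finset.mem_powerset] at hA ⊢
    refine ⟨Finset.erase_subset_erase x (Finset.subset_univ A), ?_⟩
    rw [Finset.card_erase_of_mem hA.2]
    omega
  · intro B hB
    simp only [Qfam, Finset.coe_filter, Finset.mem_filter, Finset.mem_univ, true_and,
      Set.mem_ofPred_eq, Finset.mem_powerset] at hB ⊢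
    have hx : x ∉ B := fun h => Finset.notMem_erase x _ (hB.1 h)
    rw [Finset.card_insert_of_notMem hx]
    exact ⟨by omega, Finset.mem_insert_self x B⟩
  · intro A hA
    simp only [Finset.coe_filter, Set.mem_ofPred_eq] at hA
    exact Finset.insert_erase hA.2
  · intro B hB
    simp only [Finset.coe_filter, Set.mem_ofPred_eq, Finset.mem_powerset] at hB
    exact Finset.erase_insert fun h => Finset.notMem_erase x _ (hB.1 h)

theorem card_compls {n : ℕ} (𝓕 : Finset (Finset (Fin n))) : (compls 𝓕).card = 𝓕.card :=
  Finset.card_image_of_injective _ compl_injective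

theorem degree_add_degree_compls {n : ℕ} (𝓕 : Finset (Finset (Fin n))) (x : Fin n) :
    degree 𝓕 x + degree (compls 𝓕) x = 𝓕.card := by
  have h : degree (compls 𝓕) x = (𝓕.filter (fun A => x ∉ A)).card := by
    rw [degree, compls, Finset.filter_image, Finset.card_image_of_injective _ compl_injective]
    simp only [Finset.mem_compl]
  rw [h, degree]
  exact Finset.card_filter_add_card_filter_not _

theorem degree_le_card {n : ℕ} (𝓕 : Finset (Finset (Fin n))) (x : Fin n) :
    degree 𝓕 x ≤ 𝓕.card :=
  Finset.card_filter_le _ _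

theorem degree_union_of_disjoint {n : ℕ} {𝓕 𝓖 : Finset (Finset (Fin n))} (h : Disjoint 𝓕 𝓖)
    (x : Fin n) : degree (𝓕 ∪ 𝓖) x = degree 𝓕 x + degree 𝓖 x := by
  rw [degree, Finset.filter_union,
    Finset.card_union_of_disjoint (Finset.disjoint_filter_filter h), degree, degree]

theorem degree_sdiff_add_degree {n : ℕ} {𝓕 𝓖 : Finset (Finset (Fin n))} (h : 𝓕 ⊆ 𝓖)
    (x : Fin n) : degree (𝓖 \ 𝓕) x + degree 𝓕 x = degree 𝓖 x := by
  rw [← degree_union_of_disjoint Finset.sdiff_disjoint, Finset.sdiff_union_of_subset h]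

theorem diversity_of_regular {n : ℕ} {𝓕 : Finset (Finset (Fin (n + 1)))} {d : ℕ}
    (h : ∀ x, degree 𝓕 x = d) : (diversity 𝓕 : ℤ) = 𝓕.card - d := by
  have hle : d ≤ 𝓕.card := h 0 ▸ degree_le_card 𝓕 0
  have hsup : Finset.univ.sup (fun x => degree 𝓕 x) = d := by
    simp only [h]
    exact Finset.sup_const Finset.univ_nonempty d
  have hdiv : diversity 𝓕 = 𝓕.card - d := congrArg (𝓕.card - ·) hsup
  omega


/-- Let `k ≥ 1`, `n = 2k+1`, and let `𝓐 ⊆ 2^[n]` have all members of size at most `k`, with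
both `𝓐` and `𝓐̄` regular of degrees `σ(𝓐) = a` and `σ(𝓐̄) = b`.  For `𝓡 = 𝓐 ∪ (𝓠_k \ 𝓐̄)`,
every `x ∈ [n]` lies in exactly `σ(𝓐) + σ(𝓠_k) - σ(𝓐̄)` members of `𝓡`, where
`σ(𝓠_k) = ∑_{i=k}^{2k} C(2k,i)`; consequently `|𝓡| = |𝓠_k|` and
`div(𝓡) = div(𝓠_k) + |𝓐| - 2σ(𝓐)`. -/
theorem regular_union_degree (k : ℕ) (hk : 1 ≤ k) (𝓐 : Finset (Finset (Fin (2 * k + 1))))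
    (hcard : ∀ A ∈ 𝓐, A.card ≤ k) (a b : ℕ)
    (ha : ∀ x : Fin (2 * k + 1), degree 𝓐 x = a)
    (hb : ∀ x : Fin (2 * k + 1), degree (compls 𝓐) x = b) :
    (∀ x : Fin (2 * k + 1),
      (degree (𝓐 ∪ (Qfam k \ compls 𝓐)) x : ℤ) =
        (a : ℤ) + (∑ i ∈ Finset.Icc k (2 * k), (2 * k).choose i : ℕ) - b) ∧
    (𝓐 ∪ (Qfam k \ compls 𝓐)).card = (Qfam k).card ∧
    (diversity (𝓐 ∪ (Qfam k \ compls 𝓐)) : ℤ) = (diversity (Qfam k) : ℤ) + 𝓐.card - 2 * a := by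
  have hsub : compls 𝓐 ⊆ Qfam k := by
    intro B hB
    obtain ⟨A, hA, rfl⟩ := Finset.mem_image.1 hB
    have := hcard A hA
    simp only [Qfam, Finset.mem_filter, Finset.mem_univ, true_and, Finset.card_compl,
      Fintype.card_fin]
    omega
  have hdisj : Disjoint 𝓐 (Qfam k \ compls 𝓐) := by
    refine Finset.disjoint_left.2 fun A hA hA' => ?_
    have hQ := (Finset.mem_filter.1 (Finset.mem_sdiff.1 hA').1).2
    have := hcard A hA
    omega
  have hdeg : ∀ x, degree (𝓐 ∪ (Qfam k \ compls 𝓐)) x + b =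
      a + ∑ i ∈ Finset.Icc k (2 * k), (2 * k).choose i := fun x => by
    rw [degree_union_of_disjoint hdisj, ha x, ← hb x, add_assoc, degree_sdiff_add_degree hsub,
      degree_Qfam]
  have hcardR : (𝓐 ∪ (Qfam k \ compls 𝓐)).card = (Qfam k).card := by
    have := Finset.card_sdiff_add_card_eq_card hsub
    rw [card_compls] at this
    rw [Finset.card_union_of_disjoint hdisj]
    omega
  refine ⟨fun x => by have := hdeg x; omega, hcardR, ?_⟩
  have hab : a + b = 𝓐.card := by
    rw [← degree_add_degree_compls 𝓐 0, ha, hb]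
  have hreg : ∀ x, degree (𝓐 ∪ (Qfam k \ compls 𝓐)) x =
      degree (𝓐 ∪ (Qfam k \ compls 𝓐)) 0 := fun x =>
    Nat.add_right_cancel ((hdeg x).trans (hdeg 0).symm)
  rw [diversity_of_regular hreg, diversity_of_regular (degree_Qfam k), hcardR]
  have := hdeg 0
  omega
end
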